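/- arXiv:2301.05001 — 3 statements merged into one kernel-verified Lean document; each statement's English description precedes it below -/
import Mathlib

section
/- Let R be a commutative Noetherian ring of finite Krull dimension d. Let 𝒫 ⊆ Spec(R) be a subset and δ : 𝒫 → ℕ a generalized dimension function. Let M be a finitely generated R-module such that μ_p(M) ≥ 1 + δ(p) for all p ∈ 𝒫. Let (r, m) ∈ R ⊕ M be an element that is basic at every prime in 𝒫. Then there exists m' ∈ M such that m + rm' is basic at every prime in 𝒫. Consequently, if M is a finitely generated projective R-module with rank(M_p) ≥ d for all p ∈ Spec(R) and (r, m) is a unimodular element of R ⊕ M, then there exists m' ∈ M such that height(O_M(m + rm')) ≥ d. -/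
/-- The minimal number of generators of an `R`-module `M`. -/
noncomputable def minNumGens (R M : Type*) [CommRing R] [AddCommGroup M] [Module R M] : ℕ :=
  sInf {n : ℕ | ∃ s : Finset M, s.card = n ∧ Submodule.span R (s : Set M) = ⊤}

/-- `μ_p(M)`: the minimal number of generators of the localization `M_p` over `R_p`. -/
noncomputable def muP {R : Type*} [CommRing R] (p : Ideal R) (hp : p.IsPrime)
    (M : Type*) [AddCommGroup M] [Module R M] : ℕ :=
  letI := hp
  minNumGens (Localization p.primeCompl) (LocalizedModule p.primeCompl M)

/-- `x` is a basic element of `M` at the prime `p`. -/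
def IsBasicAt {R M : Type*} [CommRing R] [AddCommGroup M] [Module R M]
    (x : M) (p : Ideal R) (hp : p.IsPrime) : Prop :=
  letI := hp
  LocalizedModule.mkLinearMap p.primeCompl M x ∉
    (p.map (algebraMap R (Localization p.primeCompl))) •
      (⊤ : Submodule (Localization p.primeCompl) (LocalizedModule p.primeCompl M))

/-- `δ` is a generalized dimension function on the subset `S` of `Spec R`. -/
def IsGenDimFun {R : Type*} [CommRing R] (S : Set (PrimeSpectrum R))
    (δ : PrimeSpectrum R → ℕ) : Prop :=
  ∀ I : Ideal R,
    Set.Finite {q | q ∈ PrimeSpectrum.zeroLocus (I : Set R) ∩ S ∧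
      ∀ p ∈ PrimeSpectrum.zeroLocus (I : Set R) ∩ S, ¬(p.asIdeal ≤ q.asIdeal ∧ δ q < δ p)}

/-- The order ideal `O_M(m) = { f m : f ∈ Hom_R(M, R) }`. -/
def orderIdeal (R : Type*) [CommRing R] {M : Type*} [AddCommGroup M] [Module R M]
    (m : M) : Ideal R where
  carrier := Set.range fun f : M →ₗ[R] R => f m
  add_mem' := by rintro a b ⟨f, rfl⟩ ⟨g, rfl⟩; exact ⟨f + g, rfl⟩
  zero_mem' := ⟨0, rfl⟩
  smul_mem' := by rintro c a ⟨f, rfl⟩; exact ⟨c • f, rfl⟩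

/-- The height of an ideal: the infimum of the heights (dimensions of the localizations) of the
primes containing it. -/
noncomputable def idealHeight {R : Type*} [CommRing R] (I : Ideal R) : WithBot (WithTop ℕ) :=
  sInf {h : WithBot (WithTop ℕ) | ∃ (p : Ideal R) (hp : p.IsPrime), I ≤ p ∧
    h = ringKrullDim (Localization (@Ideal.primeCompl R _ p hp))}

/-- The rank of the localization `M_p` at a prime `p`. -/
noncomputable def rankAt {R : Type*} [CommRing R] (M : Type*) [AddCommGroup M] [Module R M]
    (p : Ideal R) (hp : p.IsPrime) : ℕ :=
  letI := hp
  Module.finrank (Localization p.primeCompl) (LocalizedModule p.primeCompl M)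

/-- The fibre `M_p / pM_p` of a module at a prime. -/
abbrev LocalFiber {R : Type*} [CommRing R] (p : PrimeSpectrum R)
    (M : Type*) [AddCommGroup M] [Module R M] :=
  LocalizedModule p.asIdeal.primeCompl M ⧸
    (IsLocalRing.maximalIdeal (Localization.AtPrime p.asIdeal) • ⊤ :
      Submodule (Localization.AtPrime p.asIdeal) (LocalizedModule p.asIdeal.primeCompl M))

namespace LocalFiber

section

variable {R : Type*} [CommRing R] (p : PrimeSpectrum R)
  (M : Type*) [AddCommGroup M] [Module R M]

noncomputable instance : Module p.asIdeal.ResidueField (LocalFiber p M) :=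
  inferInstanceAs (Module (Localization.AtPrime p.asIdeal ⧸
    IsLocalRing.maximalIdeal (Localization.AtPrime p.asIdeal)) (LocalFiber p M))

instance : IsScalarTower (Localization.AtPrime p.asIdeal) p.asIdeal.ResidueField
    (LocalFiber p M) :=
  inferInstanceAs (IsScalarTower (Localization.AtPrime p.asIdeal) (Localization.AtPrime p.asIdeal ⧸
    IsLocalRing.maximalIdeal (Localization.AtPrime p.asIdeal)) (LocalFiber p M))

instance : IsScalarTower R p.asIdeal.ResidueField (LocalFiber p M) :=
  IsScalarTower.of_algebraMap_smul fun r x => by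
    rw [IsScalarTower.algebraMap_apply R (Localization.AtPrime p.asIdeal), algebraMap_smul,
      algebraMap_smul]

instance [Module.Finite R M] : Module.Finite p.asIdeal.ResidueField (LocalFiber p M) :=
  Module.Finite.of_restrictScalars_finite (Localization.AtPrime p.asIdeal) _ _

variable {M}

/-- The canonical map from a module to its fibre at a prime. -/
noncomputable def mk : M →ₗ[R] LocalFiber p M :=
  (Submodule.mkQ _).restrictScalars R ∘ₗ LocalizedModule.mkLinearMap p.asIdeal.primeCompl M

theorem mk_eq_zero_iff (x : M) : mk p x = 0 ↔ ¬ IsBasicAt x p.asIdeal p.isPrime := by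
  unfold IsBasicAt
  rw [not_not, Localization.AtPrime.map_eq_maximalIdeal]
  exact Submodule.Quotient.mk_eq_zero _

theorem mk_smul (r : R) (x : M) :
    mk p (r • x) = algebraMap R p.asIdeal.ResidueField r • mk p x := by
  rw [map_smul, algebraMap_smul]

theorem span_mkLinearMap_eq_top_iff [Module.Finite R M] (X : Set M) :
    Submodule.span (Localization.AtPrime p.asIdeal)
      (LocalizedModule.mkLinearMap p.asIdeal.primeCompl M '' X) = ⊤ ↔
      ∃ s ∉ p.asIdeal, ∀ m : M, s • m ∈ Submodule.span R X := by
  rw [← Submodule.localized'_span (Localization.AtPrime p.asIdeal) p.asIdeal.primeCompl]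
  constructor
  · intro h
    have key (m : M) : ∃ s : p.asIdeal.primeCompl, s • m ∈ Submodule.span R X := by
      have hm : LocalizedModule.mkLinearMap p.asIdeal.primeCompl M m ∈
          (⊤ : Submodule (Localization.AtPrime p.asIdeal) _) := trivial
      rw [← h, Submodule.mem_localized'] at hm
      obtain ⟨n, hn, s, hs⟩ := hm
      rw [IsLocalizedModule.mk'_eq_iff, ← LinearMap.map_smul_of_tower,
        IsLocalizedModule.eq_iff_exists p.asIdeal.primeCompl] at hs
      obtain ⟨c, hc⟩ := hs
      exact ⟨c * s, by rw [mul_smul, ← hc]; exact Submodule.smul_mem _ (c : R) hn⟩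
    obtain ⟨n, g, hg⟩ := Module.Finite.exists_fin (R := R) (M := M)
    choose s hs using key
    refine ⟨∏ i, (s (g i) : R), ?_, fun m => ?_⟩
    · have hprod := (∏ i, s (g i)).2
      rwa [Submonoid.coe_finsetProd] at hprod
    · have hm : m ∈ Submodule.span R (Set.range g) := hg ▸ trivial
      induction hm using Submodule.span_induction with
      | mem x hx =>
        obtain ⟨i, rfl⟩ := hx
        rw [← Finset.prod_erase_mul _ _ (Finset.mem_univ i), mul_smul]
        exact Submodule.smul_mem _ _ (hs (g i))
      | zero => simp
      | add x y _ _ hx hy => rw [smul_add]; exact add_mem hx hy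
      | smul a x _ hx => rw [smul_comm]; exact Submodule.smul_mem _ _ hx
  · rintro ⟨s, hs, h⟩
    rw [eq_top_iff]
    intro x _
    obtain ⟨⟨m, t⟩, rfl⟩ := IsLocalizedModule.mk'_surjective p.asIdeal.primeCompl
      (LocalizedModule.mkLinearMap p.asIdeal.primeCompl M) x
    rw [Submodule.mem_localized']
    refine ⟨s • m, h m, ⟨s, hs⟩ * t, ?_⟩
    exact IsLocalizedModule.mk'_cancel_left _ m ⟨s, hs⟩ t

theorem span_mk_eq_top_iff [Module.Finite R M] (X : Set M) :
    Submodule.span p.asIdeal.ResidueField (mk p '' X) = ⊤ ↔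
      ∃ s ∉ p.asIdeal, ∀ m : M, s • m ∈ Submodule.span R X := by
  rw [← span_mkLinearMap_eq_top_iff, ← IsLocalRing.map_mkQ_eq_top
      (R := Localization.AtPrime p.asIdeal), Submodule.map_span,
    ← Submodule.restrictScalars_eq_top_iff (Localization.AtPrime p.asIdeal)
      p.asIdeal.ResidueField,
    Submodule.restrictScalars_span _ _ IsLocalRing.residue_surjective, Set.image_image]
  rfl

theorem span_range_mk [Module.Finite R M] :
    Submodule.span p.asIdeal.ResidueField (Set.range (mk p (M := M))) = ⊤ := by
  rw [← Set.image_univ, span_mk_eq_top_iff]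
  exact ⟨1, p.asIdeal.one_notMem, by simp⟩

end

end LocalFiber

/-- A subspace can be completed to the whole space by `finrank V - finrank W` elements of a given
spanning family. -/
theorem exists_finset_sup_span_image_eq_top {K V α : Type*} [Field K] [AddCommGroup V] [Module K V]
    [FiniteDimensional K V] (f : α → V) (hf : Submodule.span K (Set.range f) = ⊤)
    (c : ℕ) (W : Submodule K V) (hW : Module.finrank K V ≤ c + Module.finrank K W) :
    ∃ Y : Finset α, Y.card ≤ c ∧ W ⊔ Submodule.span K (f '' Y) = ⊤ := by
  classical
  induction c generalizing W with
  | zero =>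
    refine ⟨∅, le_rfl, ?_⟩
    have := Submodule.eq_top_of_finrank_eq (le_antisymm W.finrank_le (by simpa using hW))
    simp [this]
  | succ c ih =>
    by_cases hT : W = ⊤
    · exact ⟨∅, Nat.zero_le _, by simp [hT]⟩
    obtain ⟨a, ha⟩ : ∃ a, f a ∉ W := by
      by_contra! h
      exact hT (top_le_iff.1 (hf ▸ Submodule.span_le.2 (Set.range_subset_iff.2 h)))
    have hlt : Module.finrank K W < Module.finrank K ↥(W ⊔ Submodule.span K {f a}) :=
      Submodule.finrank_lt_finrank_of_lt (lt_of_le_of_ne le_sup_left fun h =>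
        ha (h ▸ Submodule.mem_sup_right (Submodule.mem_span_singleton_self _)))
    obtain ⟨Y, hY, h⟩ := ih (W ⊔ Submodule.span K {f a}) (by omega)
    refine ⟨insert a Y, (Finset.card_insert_le _ _).trans (by omega), ?_⟩
    rw [Finset.coe_insert, Set.image_insert_eq, Submodule.span_insert, ← sup_assoc, h]

theorem finrank_le_card_add_finrank_of_sup_span_eq_top {K V α : Type*} [Field K] [AddCommGroup V]
    [Module K V] [FiniteDimensional K V] (f : α → V) (W : Submodule K V) (Y : Finset α)
    (h : W ⊔ Submodule.span K (f '' Y) = ⊤) :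
    Module.finrank K V ≤ Y.card + Module.finrank K W := by
  classical
  have h1 := Submodule.finrank_add_le_finrank_add_finrank W (Submodule.span K (f '' Y))
  rw [h, finrank_top] at h1
  have h2 := finrank_span_finset_le_card (R := K) (Y.image f)
  rw [Finset.coe_image] at h2
  have h3 : Y.card ≥ (Y.image f).card := Finset.card_image_le
  unfold Set.finrank at h2
  omega

namespace LocalFiber

section

variable {R : Type*} [CommRing R] {M : Type*} [AddCommGroup M] [Module R M] [Module.Finite R M]

theorem muP_le_finrank (p : PrimeSpectrum R) :
    muP p.asIdeal p.isPrime M ≤ Module.finrank p.asIdeal.ResidueField (LocalFiber p M) := by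
  classical
  obtain ⟨Y, hY, h⟩ := exists_finset_sup_span_image_eq_top (mk p (M := M)) (span_range_mk p)
    (Module.finrank p.asIdeal.ResidueField (LocalFiber p M)) ⊥ (by omega)
  rw [bot_sup_eq, span_mk_eq_top_iff, ← span_mkLinearMap_eq_top_iff] at h
  refine le_trans ?_ hY
  refine le_trans ?_ (Finset.card_image_le
    (f := LocalizedModule.mkLinearMap p.asIdeal.primeCompl M))
  exact Nat.sInf_le ⟨_, rfl, by rw [Finset.coe_image]; exact h⟩

/-- The rank in the fibre at `p` of a set of elements of `M`. -/
noncomputable def rk (p : PrimeSpectrum R) (X : Set M) : ℕ :=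
  Module.finrank p.asIdeal.ResidueField (Submodule.span p.asIdeal.ResidueField (mk p '' X))

/-- The fibre dimension of `M / ⟨X⟩` is upper semicontinuous. -/
theorem exists_mem_zeroLocus_iff_add_rk_le (X : Set M) (b : ℕ) :
    ∃ I : Ideal R, ∀ p : PrimeSpectrum R, p ∈ PrimeSpectrum.zeroLocus (I : Set R) ↔
      b + rk p X ≤ Module.finrank p.asIdeal.ResidueField (LocalFiber p M) := by
  cases b with
  | zero =>
    exact ⟨⊥, fun p => by
      simpa [PrimeSpectrum.mem_zeroLocus, rk] using Submodule.finrank_le _⟩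
  | succ c =>
    refine ⟨Ideal.span {s | ∃ Y : Finset M, Y.card ≤ c ∧
      ∀ m : M, s • m ∈ Submodule.span R (X ∪ Y)}, fun p => ?_⟩
    rw [PrimeSpectrum.zeroLocus_span, PrimeSpectrum.mem_zeroLocus, ← not_iff_not]
    have : ¬ (c + 1 + rk p X ≤ Module.finrank p.asIdeal.ResidueField (LocalFiber p M)) ↔
        ∃ Y : Finset M, Y.card ≤ c ∧
          Submodule.span p.asIdeal.ResidueField (mk p '' (X ∪ Y)) = ⊤ := by
      simp_rw [Set.image_union, Submodule.span_union]
      constructor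
      · intro h
        exact exists_finset_sup_span_image_eq_top _ (span_range_mk p) c _ (by unfold rk at h; omega)
      · rintro ⟨Y, hY, h⟩
        have := finrank_le_card_add_finrank_of_sup_span_eq_top _ _ _ h
        unfold rk
        omega
    rw [this, Set.not_subset]
    simp_rw [span_mk_eq_top_iff]
    constructor
    · rintro ⟨s, ⟨Y, hY, h⟩, hs⟩
      exact ⟨Y, hY, s, hs, h⟩
    · rintro ⟨Y, hY, s, hs, h⟩
      exact ⟨s, ⟨Y, hY, h⟩, hs⟩

end

end LocalFiber

/-- If `w` spans a hyperplane of the span of `w` and `v`, of dimension less than the number of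
vectors of `w`, then adding a multiple of `v` to one of them recovers `v`. -/
theorem exists_mem_span_range_add_smul {K V ι : Type*} [Field K] [AddCommGroup V] [Module K V]
    [FiniteDimensional K V] [Fintype ι] [DecidableEq ι] (w : ι → V) (v : V) (e : ι → K) (i₀ : ι)
    (h₀ : e i₀ ≠ 0 ∨ w i₀ ≠ 0) (he : ∀ i ≠ i₀, e i ≠ 0)
    (hdim : Module.finrank K (Submodule.span K (insert v (Set.range w))) ≤ Fintype.card ι)
    (hv : v ∉ Submodule.span K (Set.range w)) {t : K} (ht : t ≠ 0) :
    ∃ i, v ∈ Submodule.span K (Set.range fun j => w j + (if j = i then e j * t else 0) • v) := by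
  have hdep : ¬ LinearIndependent K w := by
    intro hli
    have h1 := finrank_span_eq_card hli
    have h2 : Submodule.span K (Set.range w) < Submodule.span K (insert v (Set.range w)) :=
      lt_of_le_of_ne (Submodule.span_mono (Set.subset_insert _ _)) fun h =>
        hv (h ▸ Submodule.subset_span (Set.mem_insert _ _))
    have h3 := Submodule.finrank_lt_finrank_of_lt h2
    omega
  obtain ⟨g, hg, i, hi⟩ := Fintype.not_linearIndependent_iff.1 hdep
  obtain ⟨i, hi⟩ : ∃ i, g i * e i ≠ 0 := by
    by_contra! h
    have hgz : ∀ j ≠ i₀, g j = 0 := fun j hj => (mul_eq_zero.1 (h j)).resolve_right (he j hj)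
    have hi0 : i = i₀ := by
      by_contra hne
      exact hi (hgz i hne)
    subst hi0
    rw [Finset.sum_eq_single i (fun j _ hj => by rw [hgz j hj, zero_smul]) (by simp)] at hg
    exact h₀.elim (fun h' => mul_ne_zero hi h' (h i)) (fun h' => smul_ne_zero hi h' hg)
  refine ⟨i, ?_⟩
  have hsum : ∑ j, g j • (w j + (if j = i then e j * t else 0) • v) = (g i * e i * t) • v := by
    simp only [smul_add, Finset.sum_add_distrib, hg, zero_add, ite_smul, zero_smul, smul_ite,
      smul_zero, Finset.sum_ite_eq', Finset.mem_univ, if_true, smul_smul, mul_assoc]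
  rw [← Submodule.smul_mem_iff _ (mul_ne_zero hi ht), ← hsum]
  exact Submodule.sum_mem _ fun j _ => Submodule.smul_mem _ _ (Submodule.subset_span ⟨j, rfl⟩)

namespace LocalFiber

section

variable {R : Type*} [CommRing R] {M : Type*} [AddCommGroup M] [Module R M]

theorem span_mk_image_le (p : PrimeSpectrum R) {X Y : Set M}
    (h : X ⊆ Submodule.span R Y) :
    Submodule.span p.asIdeal.ResidueField (mk p '' X) ≤
      Submodule.span p.asIdeal.ResidueField (mk p '' Y) := by
  rw [Submodule.span_le, Set.image_subset_iff]
  refine h.trans fun x hx => ?_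
  have := Submodule.mem_map_of_mem (f := mk p) hx
  rw [Submodule.map_span] at this
  exact Submodule.span_subset_span R p.asIdeal.ResidueField _ this

theorem rk_insert_of_mem (p : PrimeSpectrum R) {y : M} {X : Set M}
    (h : mk p y ∈ Submodule.span p.asIdeal.ResidueField (mk p '' X)) :
    rk p (insert y X) = rk p X := by
  unfold rk
  rw [Set.image_insert_eq, Submodule.span_insert_eq_span h]

variable [Module.Finite R M]

theorem rk_mono (p : PrimeSpectrum R) {X Y : Set M} (h : X ⊆ Submodule.span R Y) :
    rk p X ≤ rk p Y :=
  Submodule.finrank_mono (span_mk_image_le p h)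

theorem rk_insert_le (p : PrimeSpectrum R) (y : M) (X : Set M) :
    rk p (insert y X) ≤ rk p X + 1 := by
  unfold rk
  rw [Set.image_insert_eq, Submodule.span_insert, add_comm]
  refine (Submodule.finrank_add_le_finrank_add_finrank _ _).trans ?_
  gcongr
  exact finrank_span_le_card _ |>.trans (by simp)

theorem finrank_mono {p q : PrimeSpectrum R} (h : q ≤ p) :
    Module.finrank q.asIdeal.ResidueField (LocalFiber q M) ≤
      Module.finrank p.asIdeal.ResidueField (LocalFiber p M) := by
  obtain ⟨I, hI⟩ := exists_mem_zeroLocus_iff_add_rk_le (R := R) (M := M) ∅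
    (Module.finrank q.asIdeal.ResidueField (LocalFiber q M))
  have hrk (p : PrimeSpectrum R) : rk p (∅ : Set M) = 0 := by simp [rk]
  simp only [hrk, add_zero] at hI
  exact (hI p).1 (Set.Subset.trans ((hI q).2 le_rfl) h)

theorem exists_forall_finrank_le : ∃ N, ∀ p : PrimeSpectrum R,
    Module.finrank p.asIdeal.ResidueField (LocalFiber p M) ≤ N := by
  classical
  obtain ⟨s, hs⟩ := Module.Finite.fg_top (R := R) (M := M)
  refine ⟨s.card, fun p => ?_⟩
  have h : ⊥ ⊔ Submodule.span p.asIdeal.ResidueField (mk p '' (s : Set M)) = ⊤ := by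
    rw [bot_sup_eq, span_mk_eq_top_iff]
    exact ⟨1, p.asIdeal.one_notMem, by simp [hs]⟩
  simpa using finrank_le_card_add_finrank_of_sup_span_eq_top _ _ _ h

theorem finite_setOf_rk_le {S : Set (PrimeSpectrum R)} {δ : PrimeSpectrum R → ℕ}
    (hδ : IsGenDimFun S δ) (X : Set M) (n : ℕ) (hX : ∀ p ∈ S, min (n + 1) (δ p + 1) ≤ rk p X) :
    {p ∈ S | rk p X ≤ n ∧ rk p X ≤ δ p + 1}.Finite := by
  obtain ⟨N, hN⟩ := exists_forall_finrank_le (R := R) (M := M)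
  choose I hI using exists_mem_zeroLocus_iff_add_rk_le (R := R) X
  refine ((Set.finite_Iic N).biUnion fun b _ => hδ (I b)).subset ?_
  rintro p ⟨hp, hn, hd⟩
  have hle : rk p X ≤ Module.finrank p.asIdeal.ResidueField (LocalFiber p M) :=
    Submodule.finrank_le _
  have hNp := hN p
  refine Set.mem_biUnion (x := Module.finrank p.asIdeal.ResidueField (LocalFiber p M) - rk p X)
    (Set.mem_Iic.2 (by omega)) ⟨⟨(hI _ p).2 (by omega), hp⟩, ?_⟩
  rintro q ⟨hqI, hq⟩ ⟨hqp, hlt⟩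
  have h1 := (hI _ q).1 hqI
  have h2 := finrank_mono (M := M) (show q ≤ p from hqp)
  have h3 := hX q hq
  omega

theorem exists_forall_mem_span_range {ι : Type*} [Fintype ι] [DecidableEq ι]
    (x : ι → M) (y : M) (e : ι → R) (i₀ : ι) (E : Finset (PrimeSpectrum R))
    (h₀ : ∀ p ∈ E, e i₀ ∉ p.asIdeal ∨ mk p (x i₀) ≠ 0)
    (he : ∀ p ∈ E, ∀ i ≠ i₀, e i ∉ p.asIdeal)
    (hrk : ∀ p ∈ E, rk p (insert y (Set.range x)) ≤ Fintype.card ι) :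
    ∃ b : ι → R, ∀ p ∈ E, mk p y ∈ Submodule.span p.asIdeal.ResidueField
      (mk p '' Set.range fun j => x j + (e j * b j) • y) := by
  classical
  induction E using Finset.strongInduction with
  | H E ih =>
    obtain rfl | hE := E.eq_empty_or_nonempty
    · exact ⟨0, by simp⟩
    obtain ⟨p, hp, hmin⟩ := E.exists_minimal hE
    have hsub : ∀ q ∈ E.erase p, q ∈ E := fun q => Finset.mem_of_mem_erase
    obtain ⟨b, hb⟩ := ih _ (Finset.erase_ssubset hp) (fun q hq => h₀ q (hsub q hq))
      (fun q hq => he q (hsub q hq)) (fun q hq => hrk q (hsub q hq))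
    by_cases hv : mk p y ∈ Submodule.span p.asIdeal.ResidueField
      (mk p '' Set.range fun j => x j + (e j * b j) • y)
    · refine ⟨b, fun q hq => ?_⟩
      by_cases hqp : q = p
      · exact hqp ▸ hv
      · exact hb q (Finset.mem_erase.2 ⟨hqp, hq⟩)
    obtain ⟨t, ht, htp⟩ : ∃ t ∈ (E.erase p).inf PrimeSpectrum.asIdeal, t ∉ p.asIdeal := by
      by_contra! h
      obtain ⟨q, hq, hqp⟩ := (p.isPrime.inf_le').1 h
      exact Finset.ne_of_mem_erase hq (le_antisymm hqp (hmin (hsub q hq) hqp))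
    obtain ⟨i, hi⟩ := exists_mem_span_range_add_smul
      (fun j => mk p (x j + (e j * b j) • y)) (mk p y)
      (fun j => algebraMap R p.asIdeal.ResidueField (e j)) i₀
      (by
        rw [Ne, Ideal.algebraMap_residueField_eq_zero, or_iff_not_imp_left, not_not]
        intro h
        rw [map_add, mk_smul, Ideal.algebraMap_residueField_eq_zero.2 (p.asIdeal.mul_mem_right _ h),
          zero_smul, add_zero]
        exact (h₀ p hp).resolve_left (not_not.2 h))
      (fun j hj => by
        rw [Ne, Ideal.algebraMap_residueField_eq_zero]
        exact he p hp j hj)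
      (by
        refine le_trans ?_ (hrk p hp)
        have : rk p (insert y (Set.range fun j => x j + (e j * b j) • y)) ≤
            rk p (insert y (Set.range x)) := by
          refine rk_mono p (Set.insert_subset (Submodule.subset_span (Set.mem_insert _ _)) ?_)
          rintro _ ⟨j, rfl⟩
          exact add_mem (Submodule.subset_span (Set.mem_insert_of_mem _ ⟨j, rfl⟩))
            (Submodule.smul_mem _ _ (Submodule.subset_span (Set.mem_insert _ _)))
        unfold rk at this ⊢
        rw [Set.image_insert_eq, ← Set.range_comp] at this
        exact this)
      (by rwa [← Set.range_comp] at hv)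
      (t := algebraMap R p.asIdeal.ResidueField t)
      (by rwa [Ne, Ideal.algebraMap_residueField_eq_zero])
    refine ⟨fun j => b j + if j = i then t else 0, fun q hq => ?_⟩
    by_cases hqp : q = p
    · subst hqp
      rw [← Set.range_comp]
      suffices h : (mk q ∘ fun j => x j + (e j * (b j + if j = i then t else 0)) • y) =
          fun j => mk q (x j + (e j * b j) • y) + (if j = i then
            algebraMap R q.asIdeal.ResidueField (e j) * algebraMap R q.asIdeal.ResidueField t
            else 0) • mk q y by
        rw [h]
        exact hi
      funext j
      simp only [Function.comp_apply, map_add, mk_smul, map_mul, mul_add, add_smul, add_assoc]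
      split_ifs <;> simp
    · have hq' := Finset.mem_erase.2 ⟨hqp, hq⟩
      convert hb q hq' using 1
      rw [← Set.range_comp, ← Set.range_comp]
      congr 2
      funext j
      have htq : algebraMap R q.asIdeal.ResidueField t = 0 :=
        Ideal.algebraMap_residueField_eq_zero.2 (Finset.inf_le (f := PrimeSpectrum.asIdeal) hq' ht)
      simp only [Function.comp_apply, map_add, mk_smul, map_mul]
      split_ifs <;> simp [htq]

theorem exists_forall_mk_add_smul_ne_zero {S : Set (PrimeSpectrum R)} {δ : PrimeSpectrum R → ℕ}
    (hδ : IsGenDimFun S δ) (r : R) (n : ℕ) (x : Fin (n + 1) → M)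
    (hx : ∀ p ∈ S, min (n + 1) (δ p + 1) ≤ rk p (Set.range x))
    (h₀ : ∀ p ∈ S, r ∉ p.asIdeal ∨ mk p (x 0) ≠ 0) :
    ∃ m : M, ∀ p ∈ S, mk p (x 0 + r • m) ≠ 0 := by
  induction n with
  | zero =>
    refine ⟨0, fun p hp h => ?_⟩
    have h1 := hx p hp
    have h2 : rk p (Set.range x) = 0 := by
      rw [smul_zero, add_zero] at h
      simp [rk, Set.range_unique, h]
    omega
  | succ n ih =>
    set y := x (Fin.last _) with hy
    set z : Fin (n + 1) → M := fun j => x j.castSucc with hz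
    have hxz : Set.range x = insert y (Set.range z) := by
      rw [hy, hz]
      ext a
      simp only [Set.mem_range, Set.mem_insert_iff, eq_comm (a := a)]
      refine ⟨?_, ?_⟩
      · rintro ⟨j, rfl⟩
        induction j using Fin.lastCases with
        | last => exact Or.inl rfl
        | cast j => exact Or.inr ⟨j, rfl⟩
      · rintro (rfl | ⟨j, rfl⟩) <;> exact ⟨_, rfl⟩
    rw [hxz] at hx
    have hfin := finite_setOf_rk_le hδ _ _ hx
    obtain ⟨b, hb⟩ := exists_forall_mem_span_range z y (fun j => if j = 0 then r else 1) 0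
      hfin.toFinset
      (fun p hp => by
        rw [Set.Finite.mem_toFinset] at hp
        rw [if_pos rfl]
        exact h₀ p hp.1)
      (fun p _ i hi => by
        rw [if_neg hi]
        exact p.asIdeal.one_notMem)
      (fun p hp => by
        rw [Set.Finite.mem_toFinset] at hp
        simpa using hp.2.1)
    set z' : Fin (n + 1) → M := fun j => z j + ((if j = 0 then r else 1) * b j) • y with hz'
    have hrk (p : PrimeSpectrum R) :
        rk p (insert y (Set.range z)) ≤ rk p (insert y (Set.range z')) := by
      refine rk_mono p (Set.insert_subset (Submodule.subset_span (Set.mem_insert _ _)) ?_)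
      rintro _ ⟨j, rfl⟩
      rw [← add_sub_cancel_right (z j) (((if j = 0 then r else 1) * b j) • y)]
      exact sub_mem (Submodule.subset_span (Set.mem_insert_of_mem _ ⟨j, rfl⟩))
        (Submodule.smul_mem _ _ (Submodule.subset_span (Set.mem_insert _ _)))
    have hz0 : z' 0 = x 0 + r • b 0 • y := by
      simp [hz', hz, mul_smul]
    obtain ⟨m, hm⟩ := ih z'
      (fun p hp => by
        have h1 := hx p hp
        have h2 := hrk p
        by_cases hbad : p ∈ {p ∈ S | rk p (insert y (Set.range z)) ≤ n + 1 ∧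
            rk p (insert y (Set.range z)) ≤ δ p + 1}
        · rw [rk_insert_of_mem p (hb p (hfin.mem_toFinset.2 hbad))] at h2
          omega
        · have h3 := rk_insert_le p y (Set.range z')
          simp only [Set.mem_ofPred_eq, hp, true_and, not_and_or, not_le] at hbad
          omega)
      (fun p hp => by
        rw [or_iff_not_imp_left, not_not, hz0]
        intro hr
        rw [map_add, mk_smul, Ideal.algebraMap_residueField_eq_zero.2 hr, zero_smul, add_zero]
        exact (h₀ p hp).resolve_left (not_not.2 hr))
    refine ⟨b 0 • y + m, fun p hp => ?_⟩
    rw [smul_add, ← add_assoc, ← hz0]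
    exact hm p hp

end

end LocalFiber

section Projective

variable {R : Type*} [CommRing R] {M : Type*} [AddCommGroup M] [Module R M]

theorem finrank_le_minNumGens [Nontrivial R] [Module.Finite R M] :
    Module.finrank R M ≤ minNumGens R M := by
  have hne : {n : ℕ | ∃ s : Finset M, s.card = n ∧ Submodule.span R (s : Set M) = ⊤}.Nonempty := by
    obtain ⟨s, hs⟩ := Module.Finite.fg_top (R := R) (M := M)
    exact ⟨s.card, s, rfl, hs⟩
  obtain ⟨s, hs, h⟩ := Nat.sInf_mem hne
  have h1 := finrank_span_finset_le_card (R := R) s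
  unfold Set.finrank at h1
  rw [h, finrank_top] at h1
  exact h1.trans hs.le

theorem rankAt_le_muP [Module.Finite R M] (p : Ideal R) (hp : p.IsPrime) :
    rankAt M p hp ≤ muP p hp M :=
  finrank_le_minNumGens

/-- Basic elements of `R × M` have basic second component at primes containing the first. -/
theorem IsBasicAt.notMem_or_snd {r : R} {m : M} {p : Ideal R} {hp : p.IsPrime}
    (h : IsBasicAt ((r, m) : R × M) p hp) : r ∉ p ∨ IsBasicAt m p hp := by
  by_contra! hc
  obtain ⟨hr, hm⟩ := hc
  unfold IsBasicAt at hm h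
  rw [not_not] at hm
  refine h ?_
  have hsplit : ((r, m) : R × M) = r • (1, 0) + LinearMap.inr R R M m := by simp
  rw [hsplit, map_add, map_smul]
  refine add_mem ?_ ?_
  · rw [← algebraMap_smul (Localization p.primeCompl) r]
    exact Submodule.smul_mem_smul (Ideal.mem_map_of_mem _ hr) trivial
  · have := Submodule.mem_map_of_mem
      (f := LocalizedModule.map p.primeCompl (LinearMap.inr R R M)) hm
    rw [Submodule.map_smul''] at this
    have h1 := Submodule.smul_mono le_rfl le_top this
    rwa [LocalizedModule.mkLinearMap_apply, LocalizedModule.map_mk] at h1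

theorem isBasicAt_of_orderIdeal_eq_top {x : M} (h : orderIdeal R x = ⊤) (p : Ideal R)
    (hp : p.IsPrime) : IsBasicAt x p hp := by
  obtain ⟨f, hf⟩ : ∃ f : M →ₗ[R] R, f x = 1 := by
    have h1 : (1 : R) ∈ orderIdeal R x := h ▸ trivial
    exact h1
  intro hx
  have hx := Submodule.mem_map_of_mem
    (f := IsLocalizedModule.mapExtendScalars p.primeCompl
      (LocalizedModule.mkLinearMap p.primeCompl M)
      (Algebra.linearMap R (Localization p.primeCompl)) (Localization p.primeCompl) f) hx
  rw [Submodule.map_smul''] at hx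
  have h1 := Submodule.smul_mono le_rfl le_top hx
  rw [Localization.AtPrime.map_eq_maximalIdeal (I := p), smul_eq_mul] at h1
  have h3 := IsLocalizedModule.map_apply p.primeCompl (LocalizedModule.mkLinearMap p.primeCompl M)
    (Algebra.linearMap R (Localization p.primeCompl)) f x
  rw [hf, Algebra.linearMap_apply, map_one] at h3
  refine (Ideal.ne_top_iff_one _).1
    (IsLocalRing.maximalIdeal.isMaximal (Localization p.primeCompl)).ne_top ?_
  rw [← h3]
  rwa [Ideal.mul_top] at h1

theorem not_orderIdeal_le_of_isBasicAt [Module.Projective R M] {x : M} {p : Ideal R}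
    {hp : p.IsPrime} (h : IsBasicAt x p hp) : ¬ orderIdeal R x ≤ p := by
  intro hle
  obtain ⟨s, hs⟩ := Module.projective_def'.1 ‹Module.Projective R M›
  refine h ?_
  have hx := LinearMap.congr_fun hs x
  simp only [LinearMap.comp_apply, Finsupp.linearCombination_apply, id_eq, LinearMap.id_apply]
    at hx
  rw [← hx, Finsupp.sum, map_sum]
  refine Submodule.sum_mem _ fun a _ => ?_
  rw [map_smul, ← algebraMap_smul (Localization p.primeCompl) (s x a)]
  exact Submodule.smul_mem_smul
    (Ideal.mem_map_of_mem _ (hle ⟨Finsupp.lapply a ∘ₗ s, rfl⟩)) trivial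

end Projective

theorem le_idealHeight {R : Type*} [CommRing R] {I : Ideal R} {a : WithBot (WithTop ℕ)}
    (h : ∀ p : PrimeSpectrum R, I ≤ p.asIdeal → a ≤ (p.asIdeal.height : WithBot ℕ∞)) :
    a ≤ idealHeight I := by
  refine le_sInf ?_
  rintro b ⟨p, hp, hI, rfl⟩
  rw [IsLocalization.AtPrime.ringKrullDim_eq_height p]
  exact h ⟨p, hp⟩ hI

/-- On the primes of height less than `d`, the function `d - 1 - height` is a generalized
dimension function. -/
theorem isGenDimFun_height {R : Type*} [CommRing R] [IsNoetherianRing R] (d : ℕ) :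
    IsGenDimFun {p : PrimeSpectrum R | p.asIdeal.height < d}
      (fun p => d - 1 - p.asIdeal.height.toNat) := by
  intro I
  refine Set.Finite.subset ((Ideal.finite_minimalPrimes_of_isNoetherianRing R I).preimage
    (f := PrimeSpectrum.asIdeal) fun p _ q _ => PrimeSpectrum.ext) ?_
  rintro q ⟨⟨hqI, hq⟩, hmin⟩
  obtain ⟨p, hp, hpq⟩ := Ideal.exists_minimalPrimes_le (I := I) (J := q.asIdeal) hqI
  have hpp : p.IsPrime := hp.1.1
  obtain rfl | hlt := hpq.eq_or_lt
  · exact hp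
  exfalso
  have hq : q.asIdeal.height < d := hq
  have hht := Ideal.height_strict_mono_of_isPrime_of_isPrime hlt
  refine hmin ⟨p, hpp⟩ ⟨hp.1.2, hht.trans hq⟩ ⟨hpq, ?_⟩
  lift q.asIdeal.height to ℕ using hq.ne_top with a
  lift p.height to ℕ using hht.ne_top with b
  simp only [ENat.toNat_natCast, Nat.cast_lt] at *
  omega

theorem stmt_15 {R : Type*} [CommRing R] [IsNoetherianRing R] (d : ℕ)
    (hdim : ringKrullDim R = (d : ℕ))
    (M : Type*) [AddCommGroup M] [Module R M] [Module.Finite R M] :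
    (∀ (Pset : Set (PrimeSpectrum R)) (δ : PrimeSpectrum R → ℕ), IsGenDimFun Pset δ →
      (∀ p ∈ Pset, 1 + δ p ≤ muP p.asIdeal p.isPrime M) →
      ∀ (r : R) (m : M), (∀ p ∈ Pset, IsBasicAt ((r, m) : R × M) p.asIdeal p.isPrime) →
        ∃ m' : M, ∀ p ∈ Pset, IsBasicAt (m + r • m') p.asIdeal p.isPrime) ∧
    (Module.Projective R M → (∀ (p : Ideal R) (hp : p.IsPrime), d ≤ rankAt M p hp) →
      ∀ (r : R) (m : M), orderIdeal R ((r, m) : R × M) = ⊤ →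
        ∃ m' : M, ((d : ℕ) : WithBot (WithTop ℕ)) ≤ idealHeight (orderIdeal R (m + r • m'))) := by
  have basic_add (S : Set (PrimeSpectrum R)) (δ : PrimeSpectrum R → ℕ) (hδ : IsGenDimFun S δ)
      (hμ : ∀ p ∈ S, 1 + δ p ≤ muP p.asIdeal p.isPrime M) (r : R) (m : M)
      (hb : ∀ p ∈ S, IsBasicAt ((r, m) : R × M) p.asIdeal p.isPrime) :
      ∃ m' : M, ∀ p ∈ S, IsBasicAt (m + r • m') p.asIdeal p.isPrime := by
    obtain ⟨n, g, hg⟩ := Module.Finite.exists_fin (R := R) (M := M)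
    have key := LocalFiber.exists_forall_mk_add_smul_ne_zero hδ r n (Fin.cons m g : Fin (n + 1) → M)
      (fun p hp => by
        have htop : Submodule.span p.asIdeal.ResidueField
            (LocalFiber.mk p '' Set.range (Fin.cons m g : Fin (n + 1) → M)) = ⊤ := by
          rw [LocalFiber.span_mk_eq_top_iff]
          have hle := Submodule.span_mono (R := R) (Set.subset_insert m (Set.range g))
          rw [← Fin.range_cons, hg] at hle
          exact ⟨1, p.asIdeal.one_notMem, fun x => hle trivial⟩
        have h1 := LocalFiber.muP_le_finrank (M := M) p
        have h2 := hμ p hp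
        unfold LocalFiber.rk
        rw [htop, finrank_top]
        omega)
      (fun p hp => by
        rw [Fin.cons_zero, Ne, LocalFiber.mk_eq_zero_iff, not_not]
        exact (hb p hp).notMem_or_snd)
    simpa only [Fin.cons_zero, Ne, LocalFiber.mk_eq_zero_iff, not_not] using key
  refine ⟨basic_add, fun hproj hrank r m hu => ?_⟩
  obtain ⟨m', hm'⟩ := basic_add _ _ (isGenDimFun_height d)
    (fun p hp => by
      have h1 := hrank p.asIdeal p.isPrime
      have h2 := rankAt_le_muP (M := M) p.asIdeal p.isPrime
      have hd : d ≠ 0 := by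
        rintro rfl
        simp at hp
      omega)
    r m (fun p _ => isBasicAt_of_orderIdeal_eq_top hu _ _)
  refine ⟨m', le_idealHeight fun p hp => ?_⟩
  by_contra h
  refine not_orderIdeal_le_of_isBasicAt (hm' p ?_) hp
  have hlt := not_le.1 h
  exact_mod_cast (show (p.asIdeal.height : WithBot ℕ∞) < ((d : ℕ∞) : WithBot ℕ∞) from hlt)
end

section
/- Let A = ℤ[T² + T³, 2T] be the subring of ℤ[T] generated over ℤ by T² + T³ and 2T. Then: (1) the localization A₂ of A at the powers of 2 equals ℤ[1/2][T] (inside ℤ[1/2][T]); (2) dim(A) = 2; and (3) T² ∉ A. In particular, A is a geometric subring of ℤ[T] that is not a graded subring of ℤ[T]. -/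
open Polynomial

/-- `A` is a geometric subring of `R[T]`, where `d = dim R`. -/
def IsGeometricSubring {R : Type*} [CommRing R] (A : Subalgebra R (Polynomial R)) (d : ℕ) : Prop :=
  IsNoetherianRing A ∧
  (∃ s : R, s ∈ nonZeroDivisors R ∧ ∀ f : Polynomial R, ∃ k : ℕ, (C s) ^ k * f ∈ A) ∧
  ringKrullDim A = (d + 1 : ℕ)

/-- An integral extension of commutative rings preserves the Krull dimension. -/
theorem ringKrullDim_eq_of_isIntegral (R S : Type*) [CommRing R] [CommRing S] [Algebra R S]
    [Algebra.IsIntegral R S] [FaithfulSMul R S] : ringKrullDim R = ringKrullDim S := by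
  refine le_antisymm (iSup_le fun l ↦ ?_) ?_
  · obtain ⟨⟨P, hP, hover⟩⟩ := Ideal.nonempty_primesOver (S := S) (RelSeries.head l).asIdeal
    obtain ⟨L, hL, -, -⟩ := Ideal.exists_ltSeries_of_hasGoingUp l P
    rw [← hL]
    exact Order.LTSeries.length_le_krullDim L
  · exact Order.krullDim_le_of_strictMono (PrimeSpectrum.comap (algebraMap R S))
      fun P Q h ↦ Ideal.IsIntegral.comap_lt_comap (R := R) h

theorem exists_two_pow_mul_mem {A : Subalgebra ℤ ℤ[X]} (hA : 2 * X ∈ A) (f : ℤ[X]) :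
    ∃ k : ℕ, C (2 : ℤ) ^ k * f ∈ A := by
  have hC (a : ℤ) : C a ∈ A := A.algebraMap_mem a
  induction f using Polynomial.induction_on' with
  | add f g hf hg =>
    obtain ⟨k, hk⟩ := hf
    obtain ⟨l, hl⟩ := hg
    refine ⟨k + l, ?_⟩
    have : C (2 : ℤ) ^ (k + l) * (f + g) =
        C 2 ^ l * (C 2 ^ k * f) + C 2 ^ k * (C 2 ^ l * g) := by ring
    rw [this]
    exact add_mem (mul_mem (pow_mem (hC 2) l) hk) (mul_mem (pow_mem (hC 2) k) hl)
  | monomial n a =>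
    refine ⟨n, ?_⟩
    have : C (2 : ℤ) ^ n * monomial n a = C a * (2 * X) ^ n := by
      rw [← C_mul_X_pow_eq_monomial, mul_pow, C_ofNat]
      ring
    rw [this]
    exact mul_mem (hC a) (pow_mem hA n)

theorem isIntegral_of_X_sq_add_X_cube_mem {A : Subalgebra ℤ ℤ[X]} (hA : X ^ 2 + X ^ 3 ∈ A) :
    Algebra.IsIntegral A ℤ[X] := by
  have hX : IsIntegral A (X : ℤ[X]) := by
    refine ⟨X ^ 3 + (X ^ 2 - C ⟨X ^ 2 + X ^ 3, hA⟩), monic_X_pow_add ?_, ?_⟩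
    · compute_degree!
    · rw [eval₂_add, eval₂_sub, eval₂_X_pow, eval₂_X_pow, eval₂_C]
      change X ^ 3 + (X ^ 2 - (X ^ 2 + X ^ 3)) = (0 : ℤ[X])
      ring
  refine ⟨fun f ↦ ?_⟩
  have hf : f ∈ Algebra.adjoin ℤ {(X : ℤ[X])} := by simp [adjoin_X]
  induction hf using Algebra.adjoin_induction with
  | mem x hx => rwa [Set.mem_singleton_iff.mp hx]
  | algebraMap a => exact isIntegral_algebraMap (R := A) (x := algebraMap ℤ A a)
  | add x y _ _ hx hy => exact hx.add hy
  | mul x y _ _ hx hy => exact hx.mul hy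

theorem exists_map_eq_comp {f : ℤ[X]}
    (hf : f ∈ Algebra.adjoin ℤ {(X : ℤ[X]) ^ 2 + X ^ 3, 2 * X}) :
    ∃ p : (ZMod 2)[X], f.map (Int.castRingHom (ZMod 2)) = p.comp (X ^ 2 + X ^ 3) := by
  induction hf using Algebra.adjoin_induction with
  | mem x hx =>
    rcases hx with rfl | rfl
    · exact ⟨X, by simp⟩
    · refine ⟨0, ?_⟩
      have : (2 : (ZMod 2)[X]) = 0 := CharTwo.two_eq_zero
      simp [this]
  | algebraMap a => exact ⟨C (a : ZMod 2), by simp⟩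
  | add x y _ _ hx hy =>
    obtain ⟨p, hp⟩ := hx
    obtain ⟨q, hq⟩ := hy
    exact ⟨p + q, by simp [hp, hq]⟩
  | mul x y _ _ hx hy =>
    obtain ⟨p, hp⟩ := hx
    obtain ⟨q, hq⟩ := hy
    exact ⟨p * q, by simp [hp, hq]⟩

theorem X_sq_notMem_adjoin :
    (X : ℤ[X]) ^ 2 ∉ Algebra.adjoin ℤ {(X : ℤ[X]) ^ 2 + X ^ 3, 2 * X} := by
  intro h
  obtain ⟨p, hp⟩ := exists_map_eq_comp h
  have hdeg : (X ^ 2 + X ^ 3 : (ZMod 2)[X]).natDegree = 3 := by compute_degree!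
  have := congrArg natDegree hp
  rw [natDegree_comp, hdeg, Polynomial.map_pow, map_X, natDegree_X_pow] at this
  omega

theorem stmt_16 :
    ∀ A : Subalgebra ℤ (Polynomial ℤ),
      A = Algebra.adjoin ℤ {(X : Polynomial ℤ) ^ 2 + X ^ 3, 2 * X} →
      (∀ f : Polynomial ℤ, ∃ k : ℕ, (C (2 : ℤ)) ^ k * f ∈ A) ∧
      ringKrullDim A = (2 : ℕ) ∧
      (X : Polynomial ℤ) ^ 2 ∉ A ∧
      IsGeometricSubring A 1 ∧
      ¬(∀ f ∈ A, ∀ n : ℕ, C (f.coeff n) * X ^ n ∈ A) := by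
  intro A hA
  have hmem : (X : ℤ[X]) ^ 2 + X ^ 3 ∈ A := hA ▸ Algebra.subset_adjoin (by simp)
  have hmem' : 2 * (X : ℤ[X]) ∈ A := hA ▸ Algebra.subset_adjoin (by simp)
  have hloc := exists_two_pow_mul_mem hmem'
  have hdim : ringKrullDim A = (2 : ℕ) := by
    have := isIntegral_of_X_sq_add_X_cube_mem hmem
    rw [ringKrullDim_eq_of_isIntegral A ℤ[X], ringKrullDim_of_isNoetherianRing,
      IsPrincipalIdealRing.ringKrullDim_eq_one ℤ Int.not_isField]
    norm_num
  have hX : (X : ℤ[X]) ^ 2 ∉ A := hA ▸ X_sq_notMem_adjoin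
  have hnoeth : IsNoetherianRing A :=
    isNoetherianRing_of_fg (Subalgebra.fg_def.2 ⟨_, Set.toFinite _, hA.symm⟩)
  refine ⟨hloc, hdim, hX, ⟨hnoeth, ⟨2, by simp, hloc⟩, hdim⟩, fun h ↦ hX ?_⟩
  simpa [coeff_X_pow] using h _ hmem 2
end

section
/- Let B ⊆ C be commutative Noetherian rings and let x ∈ B be a non-zero divisor in both B and C such that B_x = C_x. Then the assignment q ↦ q ∩ B gives a one-to-one correspondence between the minimal prime ideals of C and the minimal prime ideals of B. -/
/-- If every element of `C` is multiplied into the image of `B` by a power of `x`, then inclusions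
of contracted ideals lift to `C` as soon as the larger one is a prime avoiding `x`. -/
theorem Ideal.le_of_comap_le_comap_of_pow_mul_mem_range {B C : Type*} [CommRing B] [CommRing C]
    [Algebra B C] {x : B}
    (hx : ∀ c : C, ∃ (k : ℕ) (b : B), (algebraMap B C x) ^ k * c = algebraMap B C b)
    {I q : Ideal C} [hq : q.IsPrime] (hxq : algebraMap B C x ∉ q)
    (h : I.comap (algebraMap B C) ≤ q.comap (algebraMap B C)) : I ≤ q := by
  intro c hc
  obtain ⟨k, b, hb⟩ := hx c
  have hbI : b ∈ I.comap (algebraMap B C) := by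
    rw [Ideal.mem_comap, ← hb]
    exact I.mul_mem_left _ hc
  have hbq : algebraMap B C b ∈ q := h hbI
  rw [← hb] at hbq
  exact (hq.mem_or_mem hbq).resolve_left fun hk => hxq (hq.mem_of_pow_mem k hk)

theorem stmt_18 {B C : Type*} [CommRing B] [CommRing C]
    [IsNoetherianRing B] [IsNoetherianRing C] [Algebra B C]
    (hinj : Function.Injective (algebraMap B C)) (x : B)
    (hxB : x ∈ nonZeroDivisors B) (hxC : algebraMap B C x ∈ nonZeroDivisors C)
    (hx : ∀ c : C, ∃ (k : ℕ) (b : B), (algebraMap B C x) ^ k * c = algebraMap B C b) :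
    Set.BijOn (fun q : Ideal C => q.comap (algebraMap B C))
      (minimalPrimes C) (minimalPrimes B) := by
  have hle : ∀ {I q : Ideal C}, q ∈ minimalPrimes C →
      I.comap (algebraMap B C) ≤ q.comap (algebraMap B C) → I ≤ q := by
    intro I q hq h
    have := hq.isPrime
    exact Ideal.le_of_comap_le_comap_of_pow_mul_mem_range hx
      (fun hmem => notMem_nonZeroDivisors_of_mem_mem_minimalPrimes hmem hq hxC) h
  have hsurj : ∀ p ∈ minimalPrimes B, ∃ q ∈ minimalPrimes C, q.comap (algebraMap B C) = p := by
    intro p hp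
    refine Ideal.exists_minimalPrimes_comap_eq (I := ⊥) (algebraMap B C) p ?_
    rwa [Ideal.comap_bot_of_injective _ hinj]
  refine ⟨fun q hq => ?_, fun q₁ h₁ q₂ h₂ h => ?_, hsurj⟩
  · have := hq.isPrime
    obtain ⟨p, hp, hpq⟩ := Ideal.exists_minimalPrimes_le
      (bot_le : (⊥ : Ideal B) ≤ q.comap (algebraMap B C))
    obtain ⟨q', hq', rfl⟩ := hsurj p hp
    have hq'q : q' ≤ q := hle hq hpq
    obtain rfl : q' = q := le_antisymm hq'q (hq.2 hq'.1 hq'q)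
    exact hp
  · exact le_antisymm (hle h₂ (le_of_eq h)) (hle h₁ (ge_of_eq h))
end
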